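/- For every n, there exists a subgraph of Q_n with at least |E(Q_n)|/4 edges containing no induced cycle of length 4, 6, or 10 (as a subgraph of Q_n). In particular, induced C_10 does not have the Ramsey property in the hypercube. -/

import Mathlib

/-- The parity of the number of ones of `x` at the positions in `A`. -/
def parityOn {n : ℕ} (A : Finset (Fin n)) (x : Fin n → Bool) : ZMod 2 :=
  ∑ i ∈ A, if x i then 1 else 0

/-- The vertex obtained from `x` by changing the `j`-th coordinate. -/
def flipAt {n : ℕ} (x : Fin n → Bool) (j : Fin n) : Fin n → Bool :=
  Function.update x j (!x j)

/-- The colour of the edge at `x` in direction `j`: the parities of the numbers of ones of `x`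
before and after position `j`. -/
def edgeColor {n : ℕ} (x : Fin n → Bool) (j : Fin n) : ZMod 2 × ZMod 2 :=
  (parityOn (Finset.Iio j) x, parityOn (Finset.Ioi j) x)

theorem parityOn_flipAt {n : ℕ} (A : Finset (Fin n)) (x : Fin n → Bool) (j : Fin n) :
    parityOn A (flipAt x j) = parityOn A x + if j ∈ A then 1 else 0 := by
  unfold parityOn flipAt
  have h : ∀ i, (if Function.update x j (!x j) i then (1 : ZMod 2) else 0)
      = (if x i then 1 else 0) + if i = j then 1 else 0 := by
    intro i
    by_cases hi : i = j
    · subst hi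
      cases x i
      · simp
      · simp only [Function.update_self]
        decide
    · simp [hi]
  simp only [h, Finset.sum_add_distrib, Finset.sum_ite_eq']

theorem edgeColor_flipAt {n : ℕ} (x : Fin n → Bool) (j : Fin n) :
    edgeColor (flipAt x j) j = edgeColor x j := by
  simp [edgeColor, parityOn_flipAt]

theorem flipAt_flipAt {n : ℕ} (x : Fin n → Bool) (j : Fin n) : flipAt (flipAt x j) j = x := by
  simp [flipAt]

theorem flipAt_ne {n : ℕ} (x : Fin n → Bool) (j : Fin n) : flipAt x j ≠ x := by
  intro h
  simpa [flipAt] using congrFun h j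

theorem flipAt_injective {n : ℕ} (x : Fin n → Bool) : Function.Injective (flipAt x) := by
  intro i j h
  by_contra hij
  have := congrFun h i
  simp [flipAt, hij] at this

theorem hammingDist_flipAt {n : ℕ} (x : Fin n → Bool) (j : Fin n) :
    hammingDist x (flipAt x j) = 1 := by
  rw [hammingDist, Finset.card_eq_one]
  refine ⟨j, ?_⟩
  ext i
  rw [Finset.mem_filter, Finset.mem_singleton]
  by_cases hi : i = j
  · subst hi
    simp [flipAt]
  · simp [flipAt, hi]

/-- The edges of the hypercube having colour `γ`. -/
def colorGraph (n : ℕ) (γ : ZMod 2 × ZMod 2) : SimpleGraph (Fin n → Bool) where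
  Adj x y := ∃ j, y = flipAt x j ∧ edgeColor x j = γ
  symm := ⟨by
    rintro x y ⟨j, rfl, h⟩
    exact ⟨j, (flipAt_flipAt x j).symm, by rw [edgeColor_flipAt, h]⟩⟩
  loopless := ⟨by
    rintro x ⟨j, h, -⟩
    exact flipAt_ne x j h.symm⟩

theorem card_edgeColor_le (n : ℕ) (γ : ZMod 2 × ZMod 2) :
    (Finset.univ.filter fun p : (Fin n → Bool) × Fin n => edgeColor p.1 p.2 = γ).card
      ≤ 2 * (colorGraph n γ).edgeSet.ncard := by
  classical
  rw [← SimpleGraph.coe_edgeFinset, Set.ncard_coe_finset,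
    ← SimpleGraph.sum_degrees_eq_twice_card_edges,
    Finset.card_eq_sum_card_fiberwise (f := Prod.fst) (t := Finset.univ) (by simp)]
  refine Finset.sum_le_sum fun x _ => ?_
  rw [← SimpleGraph.card_neighborFinset_eq_degree]
  refine Finset.card_le_card_of_injOn (fun p => flipAt x p.2) ?_ ?_
  · rintro ⟨y, j⟩ hp
    simp only [Finset.coe_filter, Finset.mem_filter, Finset.mem_univ, true_and,
      Set.mem_ofPred_eq] at hp
    obtain ⟨hp, rfl⟩ := hp
    exact Finset.mem_coe.mpr ((SimpleGraph.mem_neighborFinset _ _ _).mpr ⟨j, rfl, hp⟩)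
  · rintro ⟨y, j⟩ hp ⟨z, k⟩ hq h
    simp only [Finset.coe_filter, Finset.mem_filter, Finset.mem_univ, true_and,
      Set.mem_ofPred_eq] at hp hq
    rw [Prod.mk.injEq]
    exact ⟨hp.2.trans hq.2.symm, flipAt_injective x h⟩

theorem exists_large_colorGraph (n : ℕ) :
    ∃ γ, n * 2 ^ (n - 1) ≤ 4 * (colorGraph n γ).edgeSet.ncard := by
  have hsum := Finset.card_eq_sum_card_fiberwise (s := Finset.univ) (t := Finset.univ)
    (f := fun p : (Fin n → Bool) × Fin n => edgeColor p.1 p.2) (by simp)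
  by_contra! hlt
  have hle := hsum.trans_le (Finset.sum_le_sum fun γ _ => card_edgeColor_le n γ)
  have hlt' := Finset.sum_lt_sum_of_nonempty Finset.univ_nonempty (fun γ _ => hlt γ)
  rw [← Finset.mul_sum] at hle hlt'
  have hcard : (Finset.univ : Finset (ZMod 2 × ZMod 2)).card = 4 := by decide
  simp only [Finset.sum_const, hcard, smul_eq_mul, Finset.card_univ, Fintype.card_prod,
    Fintype.card_fun, Fintype.card_bool, Fintype.card_fin] at hle hlt'
  cases n with
  | zero => simp at hlt'
  | succ m =>
    rw [Nat.add_sub_cancel] at hlt'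
    rw [pow_succ] at hle
    nlinarith

/-- The values `f (s + k - 1), …, f s`, in this order. -/
def window {α : Type*} (f : ℕ → α) (s : ℕ) : ℕ → List α
  | 0 => []
  | k + 1 => f (s + k) :: window f s k

theorem length_window {α : Type*} (f : ℕ → α) (s k : ℕ) : (window f s k).length = k := by
  induction k with
  | zero => rfl
  | succ k ih => simp [window, ih]

theorem take_window {α : Type*} (f : ℕ → α) (s a k : ℕ) :
    (window f s (a + k)).take k = window f (s + a) k := by
  induction k with
  | zero => rfl
  | succ k ih => simp [← Nat.add_assoc, window, ih]

theorem map_window {α β : Type*} (g : α → β) (f : ℕ → α) (s k : ℕ) :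
    window (fun t => g (f t)) s k = (window f s k).map g := by
  induction k with
  | zero => rfl
  | succ k ih => simp [window, ih]

theorem mem_window {α : Type*} {f : ℕ → α} {s k : ℕ} {a : α} :
    a ∈ window f s k ↔ ∃ r < k, f (s + r) = a := by
  induction k with
  | zero => simp [window]
  | succ k ih =>
    rw [window, List.mem_cons, ih]
    constructor
    · rintro (rfl | ⟨r, hr, rfl⟩)
      · exact ⟨k, by simp, rfl⟩
      · exact ⟨r, by omega, rfl⟩
    · rintro ⟨r, hr, rfl⟩
      obtain h | rfl := Nat.lt_succ_iff_lt_or_eq.mp hr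
      · exact Or.inr ⟨r, h, rfl⟩
      · exact Or.inl rfl

theorem getElem?_window {α : Type*} (f : ℕ → α) (s a k : ℕ) :
    (window f s (a + k + 1))[k]? = some (f (s + a)) := by
  induction k with
  | zero => rfl
  | succ k ih => simpa [← Nat.add_assoc, window] using ih

/-- The local conditions on a list of directions, latest first, traversed by a monochromatic
induced cycle of length `L`, that involve the latest direction. -/
def Admissible (L : ℕ) : List ℕ → Prop
  | [] => True
  | j :: l =>
    (∀ i < l.length, l[i]? = some j →
      (l.take (i + 1)).countP (· < j) % 2 = 0 ∧ (l.take (i + 1)).countP (j < ·) % 2 = 0) ∧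
    ∀ i < l.length + 2, 2 ≤ i → i + 2 ≤ L →
      ∃ a b, a ≠ b ∧
        ((j :: l).take i).count a % 2 = 1 ∧ ((j :: l).take i).count b % 2 = 1

/-- Whether the part of the list before the first occurrence of `j` has evenly many entries below
`j` and evenly many above `j`, where `p` and `q` are the initial parities. -/
def isBalanced (j : ℕ) : Bool → Bool → List ℕ → Bool
  | _, _, [] => true
  | p, q, a :: l =>
    bif Nat.beq a j then !p && !q else isBalanced j (p ^^ Nat.blt a j) (q ^^ Nat.blt j a) l

/-- Remove `a` from the list if it is there, and append it otherwise. -/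
def toggle (a : ℕ) : List ℕ → List ℕ
  | [] => [a]
  | b :: o => bif Nat.beq a b then o else b :: toggle a o

/-- Whether the list has at least two entries. -/
def hasTwo : List ℕ → Bool
  | _ :: _ :: _ => true
  | _ => false

/-- Whether toggling successively the first `k` entries of a list, starting from the list `o`,
always leaves at least two entries. -/
def staysLarge : ℕ → List ℕ → List ℕ → Bool
  | 0, _, _ => true
  | _, _, [] => true
  | k + 1, o, a :: l => hasTwo (toggle a o) && staysLarge k (toggle a o) l

/-- A fast test that all admissible lists pass. -/
def isAdmissible (L : ℕ) : List ℕ → Bool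
  | [] => true
  | j :: l => isBalanced j false false l && staysLarge (L - 3) [j] l

theorem isBalanced_eq_true {j : ℕ} {l : List ℕ} (p q : Bool)
    (h : ∀ i < l.length, l[i]? = some j →
      (p.toNat + (l.take (i + 1)).countP (· < j)) % 2 = 0 ∧
        (q.toNat + (l.take (i + 1)).countP (j < ·)) % 2 = 0) :
    isBalanced j p q l = true := by
  induction l generalizing p q with
  | nil => rfl
  | cons a l ih =>
    rw [isBalanced]
    by_cases ha : a = j
    · subst ha
      have h0 := h 0 (by simp) rfl
      revert h0
      cases p <;> cases q <;> simp
    · have hbeq : Nat.beq a j = false := by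
        rwa [Bool.eq_false_iff, ne_eq, Nat.beq_eq]
      rw [hbeq, cond_false]
      refine ih _ _ fun i hi hij => ?_
      have hs := h (i + 1) (by simpa using hi) (by simpa using hij)
      rw [List.take_succ_cons, List.countP_cons, List.countP_cons] at hs
      obtain hlt | hlt := Nat.lt_or_gt_of_ne ha
      · have h1 : Nat.blt a j = true := by simpa [Nat.blt_eq] using hlt
        have h2 : Nat.blt j a = false := by
          rw [Bool.eq_false_iff, ne_eq, Nat.blt_eq]
          omega
        rw [h1, h2]
        simp only [hlt, hlt.not_gt, decide_true, decide_false, if_true, Bool.false_eq_true,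
          if_false] at hs
        cases p <;> simp at hs ⊢ <;> omega
      · have h1 : Nat.blt j a = true := by simpa [Nat.blt_eq] using hlt
        have h2 : Nat.blt a j = false := by
          rw [Bool.eq_false_iff, ne_eq, Nat.blt_eq]
          omega
        rw [h1, h2]
        simp only [hlt, hlt.not_gt, decide_true, decide_false, if_true, Bool.false_eq_true,
          if_false] at hs
        cases q <;> simp at hs ⊢ <;> omega

theorem count_toggle {a : ℕ} {o : List ℕ} (b : ℕ) :
    ((toggle a o).count b + o.count b + [a].count b) % 2 = 0 := by
  induction o with
  | nil => simp [toggle]; omega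
  | cons c o ih =>
    rw [toggle]
    by_cases hc : a = c
    · subst hc
      simp only [Nat.beq_refl, cond_true, List.count_cons, List.count_nil]
      omega
    · have hbeq : Nat.beq a c = false := by
        rwa [Bool.eq_false_iff, ne_eq, Nat.beq_eq]
      simp only [hbeq, cond_false, List.count_cons, List.count_nil] at ih ⊢
      omega

theorem hasTwo_of_mem {o : List ℕ} {a b : ℕ} (ha : a ∈ o) (hb : b ∈ o) (hab : a ≠ b) :
    hasTwo o = true := by
  match o with
  | [] => simp at ha
  | [c] => exact absurd ((List.mem_singleton.mp ha).trans (List.mem_singleton.mp hb).symm) hab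
  | _ :: _ :: _ => rfl

theorem staysLarge_eq_true {k : ℕ} {o l : List ℕ}
    (h : ∀ i < k, i < l.length → ∃ a b, a ≠ b ∧
      (o.count a + (l.take (i + 1)).count a) % 2 = 1 ∧
        (o.count b + (l.take (i + 1)).count b) % 2 = 1) :
    staysLarge k o l = true := by
  induction k generalizing o l with
  | zero => rw [staysLarge]
  | succ k ih =>
    cases l with
    | nil => rfl
    | cons c l =>
      rw [staysLarge, Bool.and_eq_true]
      constructor
      · obtain ⟨a, b, hab, ha, hb⟩ := h 0 (by omega) (by simp)
        rw [List.take_succ_cons, List.take_zero] at ha hb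
        have hca := count_toggle (a := c) (o := o) a
        have hcb := count_toggle (a := c) (o := o) b
        exact hasTwo_of_mem (List.count_pos_iff.mp (by omega)) (List.count_pos_iff.mp (by omega))
          hab
      · refine ih fun i hi hil => ?_
        obtain ⟨a, b, hab, ha, hb⟩ := h (i + 1) (by omega) (by simpa using hil)
        rw [List.take_succ_cons, List.count_cons] at ha hb
        have hca := count_toggle (a := c) (o := o) a
        have hcb := count_toggle (a := c) (o := o) b
        rw [List.count_cons, List.count_nil] at hca hcb
        exact ⟨a, b, hab, by omega, by omega⟩

theorem Admissible.isAdmissible_eq_true {L : ℕ} {l : List ℕ} (h : Admissible L l) :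
    isAdmissible L l = true := by
  cases l with
  | nil => rfl
  | cons j l =>
    rw [isAdmissible, Bool.and_eq_true]
    refine ⟨isBalanced_eq_true _ _ (by simpa using h.1), staysLarge_eq_true fun i hi hil => ?_⟩
    obtain ⟨a, b, hab, ha, hb⟩ := h.2 (i + 2) (by omega) (by omega) (by omega)
    rw [List.take_succ_cons, List.count_cons] at ha hb
    refine ⟨a, b, hab, ?_, ?_⟩ <;> rw [List.count_cons, List.count_nil] <;> omega

/-- No extension of `l` by `k` steps in five directions, all passing the test `isAdmissible`, uses
every direction an even number of times. -/
def noClosedExtension (L : ℕ) : ℕ → List ℕ → Bool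
  | 0, l => l.any fun a => Nat.beq (l.count a % 2) 1
  | k + 1, l =>
    [0, 1, 2, 3, 4].all fun j => !isAdmissible L (j :: l) || noClosedExtension L k (j :: l)

theorem exists_odd_count_of_noClosedExtension {L : ℕ} {f : ℕ → ℕ} (k t : ℕ)
    (h : noClosedExtension L k (window f 0 t) = true)
    (hf : ∀ s < t + k, f s < 5)
    (hadm : ∀ s < t + k, Admissible L (window f 0 (s + 1))) :
    ∃ a ∈ window f 0 (t + k), (window f 0 (t + k)).count a % 2 = 1 := by
  induction k generalizing t with
  | zero => simpa [noClosedExtension] using h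
  | succ k ih =>
    have hstep := hadm t (by omega)
    rw [noClosedExtension, List.all_eq_true] at h
    have ht := h (f t) (by have := hf t (by omega); simp; omega)
    rw [window, Nat.zero_add] at hstep
    rw [hstep.isAdmissible_eq_true, Bool.not_true, Bool.false_or] at ht
    have hrec := ih (t + 1) (by rw [window, Nat.zero_add]; exact ht)
      (fun s hs => hf s (by omega)) (fun s hs => hadm s (by omega))
    rwa [Nat.add_right_comm, Nat.add_assoc] at hrec

theorem noClosedExtension_nil {L : ℕ} (hL : L = 4 ∨ L = 6 ∨ L = 10) :
    noClosedExtension L L [] = true := by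
  rcases hL with rfl | rfl | rfl <;> decide +kernel

theorem parityOn_walk {n : ℕ} {V : ℕ → Fin n → Bool} {D : ℕ → Fin n}
    (hV : ∀ t, V (t + 1) = flipAt (V t) (D t)) (A : Finset (Fin n)) (s k : ℕ) :
    parityOn A (V (s + k)) = parityOn A (V s) + ((window D s k).countP (· ∈ A) : ℕ) := by
  induction k with
  | zero => simp [window]
  | succ k ih =>
    rw [← Nat.add_assoc, hV, parityOn_flipAt, ih, window, List.countP_cons]
    simp only [decide_eq_true_eq]
    push_cast
    ring

theorem even_countP_of_parityOn_eq {n : ℕ} {V : ℕ → Fin n → Bool} {D : ℕ → Fin n}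
    (hV : ∀ t, V (t + 1) = flipAt (V t) (D t)) {A : Finset (Fin n)} {s k : ℕ}
    (h : parityOn A (V (s + k)) = parityOn A (V s)) :
    (window D s k).countP (· ∈ A) % 2 = 0 := by
  rw [parityOn_walk hV, add_eq_left, ZMod.natCast_eq_zero_iff] at h
  omega

theorem ne_iff_odd_count {n : ℕ} {V : ℕ → Fin n → Bool} {D : ℕ → Fin n}
    (hV : ∀ t, V (t + 1) = flipAt (V t) (D t)) (i : Fin n) (s k : ℕ) :
    V s i ≠ V (s + k) i ↔ (window D s k).count i % 2 = 1 := by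
  have hpar : ∀ x : Fin n → Bool, parityOn {i} x = if x i then 1 else 0 := by
    intro x
    rw [parityOn, Finset.sum_singleton]
  have hcount : (window D s k).countP (· ∈ ({i} : Finset (Fin n))) = (window D s k).count i := by
    rw [List.count]
    congr 1
    funext a
    simp [beq_eq_decide]
  have h := parityOn_walk hV {i} s k
  rw [hcount, hpar, hpar] at h
  rw [← Nat.odd_iff, ← ZMod.natCast_eq_one_iff_odd]
  generalize ((window D s k).count i : ZMod 2) = c at h ⊢
  generalize V s i = p at h ⊢
  generalize V (s + k) i = q at h ⊢
  revert p q c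
  decide

/-- The number of elements of `S` below `i`. -/
def rankIn {n : ℕ} (S : Finset (Fin n)) (i : Fin n) : ℕ := (S.filter (· < i)).card

theorem rankIn_lt_rankIn {n : ℕ} {S : Finset (Fin n)} {i j : Fin n} (hi : i ∈ S) :
    rankIn S i < rankIn S j ↔ i < j := by
  constructor
  · intro h
    by_contra! hji
    refine h.not_ge (Finset.card_le_card fun a => ?_)
    simp only [Finset.mem_filter]
    exact fun ha => ⟨ha.1, ha.2.trans_le hji⟩
  · intro h
    refine Finset.card_lt_card ⟨fun a => ?_, fun hsub => ?_⟩
    · simp only [Finset.mem_filter]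
      exact fun ha => ⟨ha.1, ha.2.trans h⟩
    · have := hsub (Finset.mem_filter.mpr ⟨hi, h⟩)
      simp at this

theorem rankIn_injOn {n : ℕ} (S : Finset (Fin n)) : Set.InjOn (rankIn S) S := by
  intro i hi j hj h
  refine le_antisymm ?_ ?_
  · exact not_lt.mp fun hlt => ((rankIn_lt_rankIn hj).mpr hlt).ne h.symm
  · exact not_lt.mp fun hlt => ((rankIn_lt_rankIn hi).mpr hlt).ne h

theorem rankIn_lt_card {n : ℕ} {S : Finset (Fin n)} {i : Fin n} (hi : i ∈ S) :
    rankIn S i < S.card :=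
  Finset.card_lt_card (Finset.filter_ssubset.mpr ⟨i, hi, lt_irrefl i⟩)

theorem count_map_rankIn {n : ℕ} {S : Finset (Fin n)} {l : List (Fin n)} (hl : ∀ a ∈ l, a ∈ S)
    {i : Fin n} (hi : i ∈ S) : (l.map (rankIn S)).count (rankIn S i) = l.count i := by
  rw [List.count, List.countP_map, List.count]
  refine List.countP_congr fun a ha => ?_
  simpa using (rankIn_injOn S).eq_iff (hl a ha) hi

theorem two_mul_card_toFinset_le {α : Type*} [DecidableEq α] {l : List α}
    (h : ∀ a ∈ l, l.count a % 2 = 0) : 2 * l.toFinset.card ≤ l.length := by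
  rw [← List.sum_toFinset_count_eq_length, Nat.mul_comm, ← smul_eq_mul]
  refine Finset.card_nsmul_le_sum _ _ _ fun a ha => ?_
  have hmem := List.mem_toFinset.mp ha
  have := h a hmem
  have := List.count_pos_iff.mpr hmem
  omega

theorem admissible_window {n L : ℕ} {V : ℕ → Fin n → Bool} {D : ℕ → Fin n}
    {γ : ZMod 2 × ZMod 2} {S : Finset (Fin n)}
    (hV : ∀ t, V (t + 1) = flipAt (V t) (D t)) (hcol : ∀ t, edgeColor (V t) (D t) = γ)
    (hdist : ∀ s k, 2 ≤ k → k + 2 ≤ L → 2 ≤ hammingDist (V s) (V (s + k)))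
    (hS : ∀ t, D t ∈ S) (t : ℕ) :
    Admissible L (window (fun t => rankIn S (D t)) 0 (t + 1)) := by
  have hmem : ∀ s k, ∀ a ∈ window D s k, a ∈ S := by
    intro s k a ha
    obtain ⟨r, -, rfl⟩ := mem_window.mp ha
    exact hS _
  refine ⟨fun i hi hij => ?_, fun k hk hk2 hkL => ?_⟩
  · rw [length_window] at hi
    obtain ⟨a, rfl⟩ : ∃ a, t = a + i + 1 := ⟨t - i - 1, by omega⟩
    rw [getElem?_window, Option.some_inj] at hij
    have hD : D (a + i + 1) = D a := by
      simpa using (rankIn_injOn S (hS _) (hS _) hij).symm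
    have hc : edgeColor (V (a + (i + 1))) (D a) = edgeColor (V a) (D a) := by
      rw [hcol a, ← hD, ← Nat.add_assoc, hcol]
    have hlow := even_countP_of_parityOn_eq hV (congrArg Prod.fst hc)
    have hupp := even_countP_of_parityOn_eq hV (congrArg Prod.snd hc)
    rw [Nat.add_assoc, take_window, map_window, List.countP_map, List.countP_map, Nat.zero_add,
      Nat.zero_add, ← Nat.add_assoc]
    simp only [hD]
    refine ⟨Eq.trans (congrArg (· % 2) (List.countP_congr fun b hb => ?_)) hlow,
      Eq.trans (congrArg (· % 2) (List.countP_congr fun b hb => ?_)) hupp⟩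
    · simpa using rankIn_lt_rankIn (hmem _ _ b hb)
    · simpa using rankIn_lt_rankIn (hS a)
  · change ∃ a b, a ≠ b ∧
        ((window (fun t => rankIn S (D t)) 0 (t + 1)).take k).count a % 2 = 1 ∧
        ((window (fun t => rankIn S (D t)) 0 (t + 1)).take k).count b % 2 = 1
    rw [length_window] at hk
    obtain ⟨a, ha⟩ : ∃ a, t + 1 = a + k := ⟨t + 1 - k, by omega⟩
    rw [ha, take_window, map_window, Nat.zero_add]
    obtain ⟨i, hi, j, hj, hij⟩ := Finset.one_lt_card.mp (hdist a k hk2 hkL)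
    rw [Finset.mem_filter, ne_iff_odd_count hV] at hi hj
    have him : i ∈ window D a k := List.count_pos_iff.mp (by omega)
    have hjm : j ∈ window D a k := List.count_pos_iff.mp (by omega)
    have hiS := hmem _ _ _ him
    have hjS := hmem _ _ _ hjm
    refine ⟨_, _, (rankIn_injOn S).ne hiS hjS hij, ?_, ?_⟩
    · rw [count_map_rankIn (hmem _ _) hiS, hi.2]
    · rw [count_map_rankIn (hmem _ _) hjS, hj.2]

theorem colorGraph_not_exists_induced_cycle {n L : ℕ} (γ : ZMod 2 × ZMod 2)
    (hL : L = 4 ∨ L = 6 ∨ L = 10) :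
    ¬ ∃ v : ZMod L → (Fin n → Bool),
      Function.Injective v ∧
      (∀ i, (colorGraph n γ).Adj (v i) (v (i + 1))) ∧
      (∀ i k : ZMod L, k ≠ i → k ≠ i + 1 → i ≠ k + 1 → hammingDist (v i) (v k) ≠ 1) := by
  rintro ⟨v, hinj, hadj, hind⟩
  choose d hd hcol using hadj
  have hV : ∀ t : ℕ, v ((t + 1 : ℕ) : ZMod L) = flipAt (v (t : ZMod L)) (d (t : ZMod L)) := by
    intro t
    rw [Nat.cast_succ, hd]
  have hcast : ∀ m : ℕ, 0 < m → m < L → (m : ZMod L) ≠ 0 := by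
    intro m hm hmL h
    exact (Nat.le_of_dvd hm ((ZMod.natCast_eq_zero_iff m L).mp h)).not_gt hmL
  have hdist : ∀ s k : ℕ, 2 ≤ k → k + 2 ≤ L →
      2 ≤ hammingDist (v (s : ZMod L)) (v ((s + k : ℕ) : ZMod L)) := by
    intro s k hk hkL
    have h0 := hcast k (by omega) (by omega)
    have h1 := hcast (k - 1) (by omega) (by omega)
    have h2 := hcast (k + 1) (by omega) (by omega)
    rw [Nat.cast_sub (by omega)] at h1
    push_cast at h1 h2 ⊢
    have hne : (s : ZMod L) + k ≠ s := fun h => h0 (by linear_combination h)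
    have hone := hind s (s + k) hne (fun h => h1 (by linear_combination h))
      (fun h => h2 (by linear_combination -h))
    have hzero : hammingDist (v s) (v (s + k)) ≠ 0 :=
      hammingDist_ne_zero.mpr fun h => hne (hinj h).symm
    omega
  have hclosed : ∀ a, (window (fun t : ℕ => d (t : ZMod L)) 0 L).count a % 2 = 0 := by
    intro a
    have h := ne_iff_odd_count (V := fun t : ℕ => v (t : ZMod L)) hV a 0 L
    simp only [Nat.zero_add, Nat.cast_zero, CharP.cast_eq_zero, ne_eq, not_true_eq_false,
      false_iff] at h
    omega
  have hLpos : 0 < L := by omega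
  set S := (window (fun t : ℕ => d (t : ZMod L)) 0 L).toFinset with hSdef
  have hS : ∀ t : ℕ, d (t : ZMod L) ∈ S := by
    intro t
    rw [hSdef, List.mem_toFinset, mem_window]
    exact ⟨t % L, Nat.mod_lt _ hLpos, by simp⟩
  have hcard : S.card ≤ 5 := by
    have := two_mul_card_toFinset_le fun a (_ : a ∈ _) => hclosed a
    rw [length_window, ← hSdef] at this
    omega
  obtain ⟨a, ha, hodd⟩ := exists_odd_count_of_noClosedExtension
    (f := fun t : ℕ => rankIn S (d (t : ZMod L))) L 0 (noClosedExtension_nil hL)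
    (fun s _ => (rankIn_lt_card (hS s)).trans_le hcard)
    (fun s _ =>
      admissible_window (V := fun t : ℕ => v (t : ZMod L)) hV (fun t => hcol t) hdist hS s)
  rw [Nat.zero_add, map_window] at ha hodd
  obtain ⟨i, hi, rfl⟩ := List.mem_map.mp ha
  rw [count_map_rankIn (fun b hb => List.mem_toFinset.mpr hb) (List.mem_toFinset.mpr hi)] at hodd
  have := hclosed i
  omega

/-- For every `n` there is a subgraph of `Q_n` with at least `|E(Q_n)|/4 =
n·2^{n-1}/4` edges containing no cycle of length 4, 6 or 10 that is induced
(chordless) as a subgraph of `Q_n`; in particular induced `C₁₀` does not have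
the Ramsey property in the hypercube. -/
theorem stmt11 (n : ℕ) :
    ∃ G : SimpleGraph (Fin n → Bool),
      (∀ x y, G.Adj x y → hammingDist x y = 1) ∧
      4 * G.edgeSet.ncard ≥ n * 2 ^ (n - 1) ∧
      ∀ L : ℕ, L = 4 ∨ L = 6 ∨ L = 10 →
        ¬ ∃ v : ZMod L → (Fin n → Bool),
          Function.Injective v ∧
          (∀ i, G.Adj (v i) (v (i + 1))) ∧
          (∀ i k : ZMod L, k ≠ i → k ≠ i + 1 → i ≠ k + 1 →
            hammingDist (v i) (v k) ≠ 1) := by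
  obtain ⟨γ, hγ⟩ := exists_large_colorGraph n
  refine ⟨colorGraph n γ, ?_, hγ, fun L hL => colorGraph_not_exists_induced_cycle γ hL⟩
  rintro x y ⟨j, rfl, -⟩
  exact hammingDist_flipAt x j
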